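/- For any fixed permutation π ∈ S_k and any fixed Young diagram λ, the function s ↦ Σ_π^{sλ}, defined on positive integers s, agrees with a polynomial in s. -/

import Mathlib

open scoped BigOperators

namespace AsympRep

/-- A fixed filling: the canonical bijection between `Fin μ.card` and the cells of `μ`. -/
noncomputable def fill (μ : YoungDiagram) : Fin μ.card ≃ {c // c ∈ μ.cells} :=
  (Fintype.equivFinOfCardEq (Fintype.card_coe _)).symm

/-- Row coordinate of the box occupied by `x` in the canonical filling. -/
noncomputable def rowOf (μ : YoungDiagram) (x : Fin μ.card) : ℕ := (fill μ x).1.1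

/-- Column coordinate of the box occupied by `x` in the canonical filling. -/
noncomputable def colOf (μ : YoungDiagram) (x : Fin μ.card) : ℕ := (fill μ x).1.2

/-- The Young symmetrizer `c_μ = a_μ * b_μ` in the group algebra `ℚ[S_n]`, `n = |μ|`,
where `a_μ` is the sum of the row-preserving permutations and `b_μ` is the signed sum
of the column-preserving permutations (for the canonical filling of `μ`). -/
noncomputable def youngSymmetrizer (μ : YoungDiagram) :
    MonoidAlgebra ℚ (Equiv.Perm (Fin μ.card)) :=
  (∑ g : Equiv.Perm (Fin μ.card),
      if ∀ x, rowOf μ (g x) = rowOf μ x then MonoidAlgebra.single g (1 : ℚ) else 0) *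
  (∑ g : Equiv.Perm (Fin μ.card),
      if ∀ x, colOf μ (g x) = colOf μ x
      then MonoidAlgebra.single g ((Equiv.Perm.sign g : ℤ) : ℚ) else 0)

/-- The Specht module: the left ideal `ℚ[S_n]·c_μ`, realizing the irreducible
representation `ρ^μ` of `S_n` (by left multiplication). -/
noncomputable def spechtModule (μ : YoungDiagram) :
    Submodule ℚ (MonoidAlgebra ℚ (Equiv.Perm (Fin μ.card))) :=
  LinearMap.range (LinearMap.mulRight ℚ (youngSymmetrizer μ))

theorem spechtModule_invariant (μ : YoungDiagram) (π : Equiv.Perm (Fin μ.card)) :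
    ∀ x ∈ spechtModule μ,
      (LinearMap.mulLeft ℚ (MonoidAlgebra.single π (1 : ℚ))) x ∈ spechtModule μ := by
  rintro x ⟨y, rfl⟩
  exact ⟨MonoidAlgebra.single π (1 : ℚ) * y, by
    simp only [LinearMap.mulRight_apply, LinearMap.mulLeft_apply, mul_assoc]⟩

/-- The irreducible character `χ^μ(π) = Tr ρ^μ(π)` of the symmetric group `S_n`,
`n = |μ|`, computed as the trace of left multiplication by `π` on the Specht module. -/
noncomputable def irrChar (μ : YoungDiagram) (π : Equiv.Perm (Fin μ.card)) : ℚ :=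
  LinearMap.trace ℚ (spechtModule μ)
    ((LinearMap.mulLeft ℚ (MonoidAlgebra.single π (1 : ℚ))).restrict
      (spechtModule_invariant μ π))

/-- The normalized character
`Σ_π^μ = n(n-1)⋯(n-k+1) · Tr ρ^μ(π) / Tr ρ^μ(e)` for `π ∈ S_k`, where `π` is regarded
as a permutation of `{1,…,n}` acting as the identity on `{k+1,…,n}`; it is `0` if `k > n`. -/
noncomputable def normChar {k : ℕ} (μ : YoungDiagram) (π : Equiv.Perm (Fin k)) : ℚ :=
  if h : k ≤ μ.card then
    (μ.card.descFactorial k : ℚ)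
      * irrChar μ (π.viaEmbedding (Fin.castLEEmb h)) / irrChar μ 1
  else 0

/-- `Σ_m^μ`: the normalized character on the `m`-cycle `(1,2,…,m) ∈ S_m`. -/
noncomputable def SigmaCycle (μ : YoungDiagram) (m : ℕ) : ℚ := normChar μ (finRotate m)

/-- The dilation `sμ` of a Young diagram: every box is replaced by an `s × s` grid
of boxes. -/
def dilate (μ : YoungDiagram) (s : ℕ) : YoungDiagram where
  cells := (Finset.range (s * μ.colLen 0) ×ˢ Finset.range (s * μ.rowLen 0)).filter
      (fun c => (c.1 / s, c.2 / s) ∈ μ.cells)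
  isLowerSet := by
    intro a b hba h
    simp only [Finset.coe_filter, Set.mem_setOf_eq, Finset.mem_product,
      Finset.mem_range] at h ⊢
    exact ⟨⟨lt_of_le_of_lt hba.1 h.1.1, lt_of_le_of_lt hba.2 h.1.2⟩,
      μ.isLowerSet (Prod.mk_le_mk.mpr
        ⟨Nat.div_le_div_right hba.1, Nat.div_le_div_right hba.2⟩) h.2⟩

open scoped Classical in
/-- The `k`-th free cumulant `R_k^μ`: the coefficient of `s^k` in the polynomial
`s ↦ Σ_{k-1}^{sμ}`. -/
noncomputable def freeCumulant (μ : YoungDiagram) (k : ℕ) : ℚ :=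
  if h : ∃ p : Polynomial ℚ, ∀ s : ℕ, 0 < s →
      SigmaCycle (dilate μ s) (k - 1) = Polynomial.eval (s : ℚ) p
  then h.choose.coeff k else 0

/-- `N^μ(σ₁,σ₂)`: the number of colorings of the cycles of `σ₁` (by column numbers)
and of the cycles of `σ₂` (by row numbers) compatible with `μ`.  A coloring of the
cycles is encoded as a pair of functions on points constant on the respective cycles;
compatibility means that for every point `a` the box in column `h₁(a)` and row `h₂(a)`
belongs to `μ` (two cycles intersect precisely when they share a point). -/
noncomputable def Ncolorings {k : ℕ} (μ : YoungDiagram) (σ₁ σ₂ : Equiv.Perm (Fin k)) : ℕ :=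
  Set.ncard {h : (Fin k → ℕ) × (Fin k → ℕ) |
    (∀ a, h.1 (σ₁ a) = h.1 a) ∧ (∀ a, h.2 (σ₂ a) = h.2 a) ∧
    ∀ a, (h.2 a, h.1 a) ∈ μ.cells }

/-- `|C(σ)|`: the number of cycles of a permutation (fixed points count as cycles),
i.e. the number of orbits. -/
noncomputable def numCycles {k : ℕ} (σ : Equiv.Perm (Fin k)) : ℕ :=
  Set.ncard {s : Set (Fin k) | ∃ a, s = {b | σ.SameCycle a b}}

/-- The region of the plane occupied by the Young diagram `μ` drawn in the French
convention (row `i` of the diagram, `0`-indexed, occupies `[0, μ_i] × [i, i+1]`). -/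
def frenchRegion (μ : YoungDiagram) : Set (ℝ × ℝ) :=
  {p | 0 ≤ p.1 ∧ 0 ≤ p.2 ∧ p.1 ≤ (μ.rowLen ⌊p.2⌋.toNat : ℝ)}

/-- The parameter `S_i^μ = (i-1) ∬_{(x,y)∈μ} (x-y)^{i-2} dx dy` (French convention). -/
noncomputable def Sparam (μ : YoungDiagram) (i : ℕ) : ℝ :=
  ((i : ℝ) - 1) * ∫ p in frenchRegion μ, (p.1 - p.2) ^ (i - 2)

/-- The profile `ω : ℝ → ℝ` of a Young diagram: the boundary of the diagram drawn in
the Russian convention, i.e. the image of the French region under the rotation by `π/4`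
composed with the dilation by `√2`, `(x, y) ↦ (x - y, x + y)`.  `ω(u)` is the largest
`v` with `(u,v)` in the rotated region, and `ω(u) = |u|` away from the diagram. -/
noncomputable def profile (μ : YoungDiagram) (u : ℝ) : ℝ :=
  max |u| (sSup {v : ℝ | ((u + v) / 2, (v - u) / 2) ∈ frenchRegion μ})

/-- If `c * c = α • c`, then `α` times the trace of left multiplication by `g` on the left ideal
generated by `c` is a sum of coefficients of `c` over the conjugates of `g⁻¹`. -/
theorem mul_trace_mulLeft_range_mulRight {G : Type*} [Group G] [Fintype G]
    {c : MonoidAlgebra ℚ G} {α : ℚ}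
    (hc : c * c = α • c) (g : G)
    (hg : ∀ x ∈ LinearMap.range (LinearMap.mulRight ℚ c),
      LinearMap.mulLeft ℚ (MonoidAlgebra.single g (1 : ℚ)) x ∈
        LinearMap.range (LinearMap.mulRight ℚ c)) :
    α * LinearMap.trace ℚ (LinearMap.range (LinearMap.mulRight ℚ c))
        ((LinearMap.mulLeft ℚ (MonoidAlgebra.single g (1 : ℚ))).restrict hg) =
      ∑ h : G, c.coeff (h⁻¹ * g⁻¹ * h) := by
  classical
  set f : MonoidAlgebra ℚ G →ₗ[ℚ] MonoidAlgebra ℚ G :=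
    LinearMap.mulRight ℚ c ∘ₗ LinearMap.mulLeft ℚ (MonoidAlgebra.single g (1 : ℚ)) with hf
  have hmem : ∀ x, f x ∈ LinearMap.range (LinearMap.mulRight ℚ c) := fun x => ⟨_, rfl⟩
  have : Module.Finite ℚ (MonoidAlgebra ℚ G) :=
    Module.Finite.of_basis (MonoidAlgebra.basis G ℚ)
  have : Module.Free ℚ (MonoidAlgebra ℚ G) :=
    Module.Free.of_basis (MonoidAlgebra.basis G ℚ)
  have key := f.trace_restrict_eq_of_forall_mem _ hmem
  have hrestrict : f.restrict (fun x _ => hmem x) =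
      α • (LinearMap.mulLeft ℚ (MonoidAlgebra.single g (1 : ℚ))).restrict hg := by
    ext1 ⟨x, y, rfl⟩
    apply Subtype.ext
    simp [hf, mul_assoc, hc]
  rw [hrestrict, map_smul, smul_eq_mul] at key
  rw [key, LinearMap.trace_eq_matrix_trace ℚ (MonoidAlgebra.basis G ℚ), Matrix.trace]
  refine Finset.sum_congr rfl fun h _ => ?_
  have : ((MonoidAlgebra.basis G ℚ).repr (f (MonoidAlgebra.single h 1))) h =
      (f (MonoidAlgebra.single h 1)).coeff h := rfl
  rw [Matrix.diag_apply, LinearMap.toMatrix_apply, MonoidAlgebra.basis_apply, this]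
  simp [hf, MonoidAlgebra.coeff_single_mul_apply, mul_assoc]

section Symmetrizers

variable {X : Type*} [Fintype X] [DecidableEq X]

/-- The sum of the permutations preserving the labelling `r`. -/
noncomputable def rowSum (r : X → ℕ) : MonoidAlgebra ℚ (Equiv.Perm X) :=
  ∑ g : Equiv.Perm X, if ∀ x, r (g x) = r x then MonoidAlgebra.single g (1 : ℚ) else 0

/-- The signed sum of the permutations preserving the labelling `c`. -/
noncomputable def colSum (c : X → ℕ) : MonoidAlgebra ℚ (Equiv.Perm X) :=
  ∑ g : Equiv.Perm X, if ∀ x, c (g x) = c x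
    then MonoidAlgebra.single g ((Equiv.Perm.sign g : ℤ) : ℚ) else 0

theorem rowSum_mul_single {r : X → ℕ} {p : Equiv.Perm X} (hp : ∀ x, r (p x) = r x) :
    rowSum r * MonoidAlgebra.single p 1 = rowSum r := by
  unfold rowSum
  rw [Finset.sum_mul]
  refine Fintype.sum_equiv (Equiv.mulRight p) _ _ fun g => ?_
  have : (∀ x, r ((g * p) x) = r x) ↔ ∀ x, r (g x) = r x := by
    refine ⟨fun h x => ?_, fun h x => (h _).trans (hp x)⟩
    have h1 := h (p⁻¹ x)
    have h2 := hp (p⁻¹ x)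
    simp only [Equiv.Perm.mul_apply, Equiv.Perm.coe_inv, Equiv.apply_symm_apply] at h1 h2
    rw [h1, ← h2]
  simp only [Equiv.coe_mulRight, this]
  split_ifs <;> simp

theorem single_mul_colSum {c : X → ℕ} {q : Equiv.Perm X} (hq : ∀ x, c (q x) = c x) :
    MonoidAlgebra.single q 1 * colSum c = ((Equiv.Perm.sign q : ℤ) : ℚ) • colSum c := by
  unfold colSum
  rw [Finset.mul_sum, Finset.smul_sum]
  refine Fintype.sum_equiv (Equiv.mulLeft q) _ _ fun g => ?_
  have : (∀ x, c ((q * g) x) = c x) ↔ ∀ x, c (g x) = c x := by simp [hq]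
  simp only [Equiv.coe_mulLeft, this]
  split_ifs
  · rcases Int.units_eq_one_or (Equiv.Perm.sign q) with h | h <;> simp [h]
  · simp

/-- Whenever `h` never sends two points of the same row into the same column, some row-preserving
permutation has the same effect as `h` on columns. -/
def Factors (r c : X → ℕ) : Prop :=
  ∀ h : Equiv.Perm X, (∀ x y, x ≠ y → r x = r y → c (h x) ≠ c (h y)) →
    ∃ p : Equiv.Perm X, (∀ x, r (p x) = r x) ∧ ∀ x, c (p x) = c (h x)

/-- The von Neumann lemma: sandwiching any element between the row sum and the signed column sum gives
a multiple of the Young symmetrizer. -/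
theorem exists_rowSum_mul_mul_colSum {r c : X → ℕ} (H : Factors r c)
    (x : MonoidAlgebra ℚ (Equiv.Perm X)) :
    ∃ α : ℚ, rowSum r * x * colSum c = α • (rowSum r * colSum c) := by
  induction x using MonoidAlgebra.induction_linear with
  | zero => exact ⟨0, by simp⟩
  | add x y hx hy =>
    obtain ⟨α, hα⟩ := hx
    obtain ⟨β, hβ⟩ := hy
    exact ⟨α + β, by rw [mul_add, add_mul, hα, hβ, add_smul]⟩
  | single h t =>
    have ht : MonoidAlgebra.single h t = t • MonoidAlgebra.single h (1 : ℚ) := by simp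
    suffices ∃ α : ℚ, rowSum r * MonoidAlgebra.single h 1 * colSum c
        = α • (rowSum r * colSum c) by
      obtain ⟨α, hα⟩ := this
      exact ⟨t * α, by rw [ht, mul_smul_comm, smul_mul_assoc, hα, smul_smul]⟩
    by_cases hh : ∀ x y, x ≠ y → r x = r y → c (h⁻¹ x) ≠ c (h⁻¹ y)
    · obtain ⟨p, hp, hpc⟩ := H h⁻¹ hh
      have hp' : ∀ x, r (p⁻¹ x) = r x := fun x => by simpa using (hp (p⁻¹ x)).symm
      have hq : ∀ x, c ((p * h) x) = c x := fun x => by simp [hpc]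
      refine ⟨((Equiv.Perm.sign (p * h) : ℤ) : ℚ), ?_⟩
      have hfac : MonoidAlgebra.single h (1 : ℚ) =
          MonoidAlgebra.single p⁻¹ 1 * MonoidAlgebra.single (p * h) 1 := by simp
      rw [hfac, ← mul_assoc, rowSum_mul_single hp', mul_assoc, single_mul_colSum hq,
        mul_smul_comm]
    · push Not at hh
      obtain ⟨x, y, hxy, hr, hc⟩ := hh
      refine ⟨0, ?_⟩
      have h1 : ∀ z, r (Equiv.swap x y z) = r z := fun z => by
        rw [Equiv.swap_apply_def]; split_ifs <;> simp_all
      have h2 : ∀ z, c (Equiv.swap (h⁻¹ x) (h⁻¹ y) z) = c z := fun z => by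
        rw [Equiv.swap_apply_def]; split_ifs <;> simp_all
      have hconj : Equiv.swap x y * h = h * Equiv.swap (h⁻¹ x) (h⁻¹ y) := by
        rw [Equiv.mul_swap_eq_swap_mul]; simp
      have hneg : rowSum r * MonoidAlgebra.single h 1 * colSum c =
          -(rowSum r * MonoidAlgebra.single h 1 * colSum c) := by
        conv_lhs => rw [← rowSum_mul_single h1]
        rw [mul_assoc (rowSum r), MonoidAlgebra.single_mul_single, hconj,
          ← MonoidAlgebra.single_mul_single, ← mul_assoc, mul_assoc _ _ (colSum c),
          single_mul_colSum h2, Equiv.Perm.sign_swap (by simpa using hxy)]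
        simp
      rw [zero_smul]
      have := IsAddTorsionFree.of_module_rat (MonoidAlgebra ℚ (Equiv.Perm X))
      exact self_eq_neg.mp hneg

end Symmetrizers

/-- A family of cells indexed by the cells of `μ` whose row and column coordinates are, up to a
permutation, those of `μ`, and whose members are distinct, consists of cells of `μ`. -/
theorem mem_cells_of_injective (μ : YoungDiagram) (h : Equiv.Perm {c // c ∈ μ.cells})
    (hinj : Function.Injective fun x : {c // c ∈ μ.cells} => (x.1.1, (h x).1.2))
    (x : {c // c ∈ μ.cells}) : (x.1.1, (h x).1.2) ∈ μ.cells := by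
  classical
  set w : ℕ × ℕ → ℤ := fun z => (z.2 : ℤ) - μ.rowLen z.1 with hw
  set I : Finset (ℕ × ℕ) := Finset.univ.image fun x : {c // c ∈ μ.cells} => (x.1.1, (h x).1.2)
    with hI
  have hsum : ∑ z ∈ I, w z = ∑ z ∈ μ.cells, w z := by
    rw [hI, Finset.sum_image hinj.injOn, ← Finset.sum_coe_sort μ.cells w]
    simp only [hw, Finset.sum_sub_distrib]
    rw [Equiv.sum_comp h fun x : {c // c ∈ μ.cells} => ((x.1.2 : ℕ) : ℤ)]
  have hcard : I.card = μ.cells.card := by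
    rw [hI, Finset.card_image_of_injective _ hinj]; simp
  have hmem : ∀ z, z ∈ μ.cells ↔ w z < 0 := fun z => by
    rw [YoungDiagram.mem_cells, ← Prod.mk.eta (p := z), YoungDiagram.mem_iff_lt_rowLen]
    simp [hw]
  have hdiff := Finset.sum_sdiff_sub_sum_sdiff (s₁ := μ.cells) (s₂ := I) (f := w)
  have hsub : μ.cells ⊆ I := by
    rw [← Finset.sdiff_eq_empty_iff_subset]
    by_contra hne
    have h1 : ∑ z ∈ μ.cells \ I, w z < 0 :=
      Finset.sum_neg (fun z hz => (hmem z).1 (Finset.mem_sdiff.1 hz).1)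
        (Finset.nonempty_iff_ne_empty.2 hne)
    have h2 : 0 ≤ ∑ z ∈ I \ μ.cells, w z :=
      Finset.sum_nonneg fun z hz => not_lt.1 fun hlt => (Finset.mem_sdiff.1 hz).2 ((hmem z).2 hlt)
    linarith
  have hx : (x.1.1, (h x).1.2) ∈ I := Finset.mem_image_of_mem _ (Finset.mem_univ x)
  exact (Finset.ext_iff.1 (Finset.eq_of_subset_of_card_le hsub hcard.le) _).2 hx

theorem factors_rowOf_colOf (μ : YoungDiagram) : Factors (rowOf μ) (colOf μ) := by
  intro h hh
  have hinj : Function.Injective fun x : {c // c ∈ μ.cells} =>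
      (x.1.1, ((fill μ).permCongr h x).1.2) := by
    intro x y hxy
    by_contra hne
    refine hh ((fill μ).symm x) ((fill μ).symm y) (by simpa using hne) ?_ ?_
    · simpa [rowOf] using congrArg Prod.fst hxy
    · simpa [colOf] using congrArg Prod.snd hxy
  have hmem := mem_cells_of_injective μ ((fill μ).permCongr h) hinj
  set P : {c // c ∈ μ.cells} → {c // c ∈ μ.cells} := fun x => ⟨_, hmem x⟩ with hP
  have hPinj : Function.Injective P := fun x y hxy => hinj (congrArg Subtype.val hxy)
  refine ⟨(fill μ).symm.permCongr (Equiv.ofBijective P (Finite.injective_iff_bijective.1 hPinj)),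
    fun x => ?_, fun x => ?_⟩
  · simp [rowOf, hP]
  · simp [colOf, hP]

theorem youngSymmetrizer_eq (μ : YoungDiagram) :
    youngSymmetrizer μ = rowSum (rowOf μ) * colSum (colOf μ) := by
  unfold youngSymmetrizer rowSum colSum
  congr!

theorem exists_youngSymmetrizer_mul_self (μ : YoungDiagram) :
    ∃ α : ℚ, youngSymmetrizer μ * youngSymmetrizer μ = α • youngSymmetrizer μ := by
  obtain ⟨α, hα⟩ := exists_rowSum_mul_mul_colSum (factors_rowOf_colOf μ)
    (colSum (colOf μ) * rowSum (rowOf μ))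
  exact ⟨α, by rw [youngSymmetrizer_eq, ← hα]; simp only [mul_assoc]⟩

section SignedFactorizations

variable {X Y : Type*} [Fintype X] [DecidableEq X] [Fintype Y] [DecidableEq Y]

/-- The signed number of factorizations `π = σ * τ` in which `σ` preserves the first coordinate of
the filling `F` and `τ` preserves the second one, each weighted by the sign of `τ`. -/
def signedFactorizations (π : Equiv.Perm X) (F : X → ℕ × ℕ) : ℚ :=
  ∑ τ : Equiv.Perm X,
    if (∀ x, (F (τ x)).2 = (F x).2) ∧ ∀ x, (F ((π * τ⁻¹) x)).1 = (F x).1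
    then ((Equiv.Perm.sign τ : ℤ) : ℚ) else 0

theorem coeff_rowSum_mul_colSum (r c : X → ℕ) (π : Equiv.Perm X) :
    (rowSum r * colSum c).coeff π = signedFactorizations π fun x => (r x, c x) := by
  unfold colSum signedFactorizations
  rw [Finset.mul_sum, MonoidAlgebra.coeff_sum, Finset.sum_apply']
  refine Finset.sum_congr rfl fun τ _ => ?_
  have hrow : ∀ g, (rowSum r).coeff g = if ∀ x, r (g x) = r x then 1 else 0 := fun g => by
    unfold rowSum
    rw [MonoidAlgebra.coeff_sum, Finset.sum_apply', Finset.sum_eq_single g]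
    · split_ifs <;> simp
    · intro b _ hb
      split_ifs <;> simp [hb]
    · simp
  by_cases hc : ∀ x, c (τ x) = c x
  · by_cases hr : ∀ x, r (π (τ.symm x)) = r x <;>
      simp [hc, MonoidAlgebra.coeff_mul_single_apply, hrow, hr]
  · simp [hc]

theorem signedFactorizations_conj (e : X ≃ Y) (π : Equiv.Perm Y) (F : X → ℕ × ℕ) :
    signedFactorizations (e.symm.permCongr π) F = signedFactorizations π (F ∘ e.symm) := by
  refine Fintype.sum_equiv e.permCongr _ _ fun τ => ?_
  have h1 : (∀ x, (F (τ x)).2 = (F x).2) ↔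
      ∀ y, ((F ∘ e.symm) (e.permCongr τ y)).2 = ((F ∘ e.symm) y).2 := by
    rw [← e.forall_congr_right]; simp
  have h2 : (∀ x, (F ((e.symm.permCongr π * τ⁻¹) x)).1 = (F x).1) ↔
      ∀ y, ((F ∘ e.symm) ((π * (e.permCongr τ)⁻¹) y)).1 = ((F ∘ e.symm) y).1 := by
    rw [← e.forall_congr_right (q := fun y => ((F ∘ e.symm) ((π * (e.permCongr τ)⁻¹) y)).1 = _)]
    simp [Equiv.permCongr_def]
  simp only [h1, h2, Equiv.Perm.sign_permCongr]

theorem signedFactorizations_one {F : X → ℕ × ℕ} (hF : Function.Injective F) :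
    signedFactorizations 1 F = 1 := by
  unfold signedFactorizations
  rw [Finset.sum_eq_single 1]
  · simp
  · intro τ _ hτ
    rw [if_neg]
    rintro ⟨h1, h2⟩
    refine hτ (Equiv.ext fun x => hF (Prod.ext ?_ (h1 x)))
    simpa using (h2 (τ x)).symm
  · simp

theorem signedFactorizations_eq_zero {F : X → ℕ × ℕ} (hF : ¬ Function.Injective F)
    (π : Equiv.Perm X) : signedFactorizations π F = 0 := by
  obtain ⟨a, b, hab, hne⟩ : ∃ a b, F a = F b ∧ a ≠ b := by
    simpa [Function.Injective] using hF
  have hswap : ∀ x, F (Equiv.swap a b x) = F x := fun x => by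
    rw [Equiv.swap_apply_def]; split_ifs <;> simp_all
  refine self_eq_neg.mp ?_
  conv_rhs => rw [signedFactorizations, ← Finset.sum_neg_distrib]
  refine Fintype.sum_equiv (Equiv.mulLeft (Equiv.swap a b)) _ _ fun τ => ?_
  have h1 : (∀ x, (F ((Equiv.swap a b * τ) x)).2 = (F x).2) ↔ ∀ x, (F (τ x)).2 = (F x).2 := by
    simp [hswap]
  have h2 : (∀ x, (F ((π * (Equiv.swap a b * τ)⁻¹) x)).1 = (F x).1) ↔
      ∀ x, (F ((π * τ⁻¹) x)).1 = (F x).1 := by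
    rw [← (Equiv.swap a b).forall_congr_right
      (q := fun x => (F ((π * (Equiv.swap a b * τ)⁻¹) x)).1 = _)]
    simp [hswap]
  simp only [Equiv.coe_mulLeft, h1, h2]
  split_ifs <;> simp [Equiv.Perm.sign_swap hne]

theorem signedFactorizations_viaEmbedding (ι : Y ↪ X) (π : Equiv.Perm Y) {F : X → ℕ × ℕ}
    (hF : Function.Injective F) :
    signedFactorizations (π.viaEmbedding ι) F = signedFactorizations π (F ∘ ι) := by
  symm
  refine Finset.sum_of_injOn (Equiv.Perm.viaEmbeddingHom ι)
    (Equiv.Perm.viaEmbeddingHom_injective ι).injOn (by simp) ?_ ?_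
  · intro τ _ hτ
    rw [if_neg]
    rintro ⟨h1, h2⟩
    refine hτ ?_
    have hfix : ∀ x ∉ Set.range ι, τ x = x := fun x hx => by
      refine hF (Prod.ext ?_ (h1 x))
      have := h2 (τ x)
      simpa [Equiv.Perm.viaEmbedding_apply_of_notMem _ _ _ hx] using this.symm
    have hrange : ∀ y, ∃ y', ι y' = τ (ι y) := fun y => by
      by_contra hy
      exact hy ⟨y, (τ.injective (hfix _ hy)).symm⟩
    choose t ht using hrange
    have htinj : Function.Injective t := fun y y' h => by
      apply ι.injective; apply τ.injective; rw [← ht, ← ht, h]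
    refine ⟨Equiv.ofBijective t (Finite.injective_iff_bijective.1 htinj), by simp, ?_⟩
    ext1 x
    by_cases hx : x ∈ Set.range ι
    · obtain ⟨y, rfl⟩ := hx
      rw [Equiv.Perm.viaEmbeddingHom_apply, Equiv.Perm.viaEmbedding_apply, ← ht]; rfl
    · rw [Equiv.Perm.viaEmbeddingHom_apply, Equiv.Perm.viaEmbedding_apply_of_notMem _ _ _ hx,
        hfix x hx]
  · intro τ _
    have hforall : ∀ (σ : Equiv.Perm Y) (f : ℕ × ℕ → ℕ),
        (∀ x, f (F (Equiv.Perm.viaEmbeddingHom ι σ x)) = f (F x)) ↔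
          ∀ y, f ((F ∘ ι) (σ y)) = f ((F ∘ ι) y) := fun σ f => by
      refine ⟨fun h y => ?_, fun h x => ?_⟩
      · simpa [Equiv.Perm.viaEmbeddingHom_apply, Equiv.Perm.viaEmbedding_apply] using h (ι y)
      · by_cases hx : x ∈ Set.range ι
        · obtain ⟨y, rfl⟩ := hx
          simpa [Equiv.Perm.viaEmbeddingHom_apply, Equiv.Perm.viaEmbedding_apply] using h y
        · rw [Equiv.Perm.viaEmbeddingHom_apply,
            Equiv.Perm.viaEmbedding_apply_of_notMem _ _ _ hx]
    have hsign : Equiv.Perm.sign (Equiv.Perm.viaEmbeddingHom ι τ) = Equiv.Perm.sign τ := by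
      classical
      rw [Equiv.Perm.viaEmbeddingHom_apply, Equiv.Perm.viaEmbedding]
      convert Equiv.Perm.sign_extendDomain τ (Equiv.ofInjective ι.1 ι.2)
    rw [← Equiv.Perm.viaEmbeddingHom_apply, ← map_inv, ← map_mul]
    simp only [hforall _ Prod.fst, hforall _ Prod.snd, hsign]

end SignedFactorizations

/-- Averaging over permutations of `X` a function of the restriction to `Y` amounts to averaging over
the injections of `Y` into `X`. -/
theorem descFactorial_mul_sum_perm {X Y : Type*} [Fintype X] [DecidableEq X] [Fintype Y]
    [DecidableEq Y] (Φ : (Y → X) → ℚ) (hΦ : ∀ f, ¬ Function.Injective f → Φ f = 0) (ι : Y ↪ X) :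
    ((Fintype.card X).descFactorial (Fintype.card Y) : ℚ) * ∑ g : Equiv.Perm X, Φ (g ∘ ι) =
      (Fintype.card X).factorial * ∑ f : Y → X, Φ f := by
  have hconst : ∀ f : Y ↪ X, ∑ g : Equiv.Perm X, Φ (g ∘ f) = ∑ g : Equiv.Perm X, Φ (g ∘ ι) := by
    intro f
    obtain ⟨e, he⟩ := Equiv.Perm.exists_extending_pair f ι f.injective ι.injective
    refine (Fintype.sum_equiv (Equiv.mulRight e) _ _ fun g => ?_).symm
    congr 1
    ext y
    simp [he]
  have hemb : ∑ f : Y ↪ X, Φ f = ∑ f : Y → X, Φ f := by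
    refine Finset.sum_of_injOn (fun f : Y ↪ X => (f : Y → X)) DFunLike.coe_injective.injOn
      (by simp) (fun f _ hf => hΦ f fun hinj => hf ?_) (fun _ _ => rfl)
    exact ⟨⟨f, hinj⟩, by simp, rfl⟩
  have hperm : ∀ g : Equiv.Perm X, ∑ f : Y ↪ X, Φ (g ∘ f) = ∑ f : Y ↪ X, Φ f := fun g =>
    Fintype.sum_equiv (Equiv.embeddingCongr (Equiv.refl Y) g) _ _ fun f => rfl
  calc _ = ∑ f : Y ↪ X, ∑ g : Equiv.Perm X, Φ (g ∘ f) := by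
        simp [hconst, Fintype.card_embedding_eq]
    _ = ∑ g : Equiv.Perm X, ∑ f : Y ↪ X, Φ (g ∘ f) := Finset.sum_comm
    _ = _ := by simp [hperm, hemb, Fintype.card_perm]

theorem mul_irrChar {μ : YoungDiagram} {α : ℚ}
    (hα : youngSymmetrizer μ * youngSymmetrizer μ = α • youngSymmetrizer μ)
    (π : Equiv.Perm (Fin μ.card)) :
    α * irrChar μ π =
      ∑ g : Equiv.Perm (Fin μ.card), signedFactorizations π⁻¹ fun x => (fill μ (g x)).1 := by
  refine (mul_trace_mulLeft_range_mulRight hα π (spechtModule_invariant μ π)).trans ?_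
  refine Fintype.sum_equiv (Equiv.inv _) _ _ fun g => ?_
  rw [youngSymmetrizer_eq, coeff_rowSum_mul_colSum]
  exact signedFactorizations_conj g π⁻¹ fun x => (rowOf μ x, colOf μ x)

theorem normChar_eq_sum {k : ℕ} (μ : YoungDiagram) (π : Equiv.Perm (Fin k)) :
    normChar μ π = ∑ f : Fin k → {c // c ∈ μ.cells},
      signedFactorizations π⁻¹ fun y => (f y).1 := by
  unfold normChar
  split_ifs with h
  · obtain ⟨α, hα⟩ := exists_youngSymmetrizer_mul_self μ
    have hfill : Function.Injective fun x => (fill μ x).1 :=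
      Subtype.val_injective.comp (fill μ).injective
    have hone : α * irrChar μ 1 = (μ.card.factorial : ℚ) := by
      have hg : ∀ g : Equiv.Perm (Fin μ.card),
          (signedFactorizations 1 fun x => (fill μ (g x)).1) = 1 := fun g =>
        signedFactorizations_one (hfill.comp g.injective)
      simp [mul_irrChar hα, hg, Fintype.card_perm]
    have hne : α * irrChar μ 1 ≠ 0 := by
      rw [hone]; exact_mod_cast Nat.factorial_ne_zero _
    have hπ : α * irrChar μ (π.viaEmbedding (Fin.castLEEmb h)) =
        ∑ g : Equiv.Perm (Fin μ.card),
          signedFactorizations π⁻¹ fun y => (fill μ (g (Fin.castLEEmb h y))).1 := by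
      rw [mul_irrChar hα]
      refine Finset.sum_congr rfl fun g _ => ?_
      rw [← Equiv.Perm.viaEmbeddingHom_apply, ← map_inv, Equiv.Perm.viaEmbeddingHom_apply]
      exact signedFactorizations_viaEmbedding _ _ (hfill.comp g.injective)
    have hcount := descFactorial_mul_sum_perm
      (fun f : Fin k → Fin μ.card => signedFactorizations π⁻¹ fun y => (fill μ (f y)).1)
      (fun f hf => signedFactorizations_eq_zero
        (fun hinj => hf (Function.Injective.of_comp (f := fun x => (fill μ x).1) hinj)) _)
      (Fin.castLEEmb h)
    simp only [Fintype.card_fin, Function.comp_apply, ← hπ, ← hone] at hcount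
    have hα0 : α ≠ 0 := left_ne_zero_of_mul hne
    have h10 : irrChar μ 1 ≠ 0 := right_ne_zero_of_mul hne
    rw [div_eq_iff h10]
    refine mul_left_cancel₀ hα0 ?_
    rw [← Fintype.sum_equiv (Equiv.arrowCongr (Equiv.refl (Fin k)) (fill μ))
      (fun f => signedFactorizations π⁻¹ fun y => (fill μ (f y)).1) _ fun f => rfl]
    linear_combination hcount
  · refine (Finset.sum_eq_zero fun f _ => signedFactorizations_eq_zero (fun hinj => h ?_) _).symm
    have := Fintype.card_le_of_injective f
      (Function.Injective.of_comp (f := Subtype.val) hinj)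
    simpa using this

section Dilation

/-- A cell of the dilated diagram is a cell of `μ` together with a position in an `s × s` grid. -/
def dilateCellsEquiv (μ : YoungDiagram) {s : ℕ} (hs : 0 < s) :
    {c // c ∈ (dilate μ s).cells} ≃ {c // c ∈ μ.cells} × Fin s × Fin s where
  toFun c := (⟨(c.1.1 / s, c.1.2 / s), (Finset.mem_filter.1 c.2).2⟩,
    ⟨c.1.1 % s, Nat.mod_lt _ hs⟩, ⟨c.1.2 % s, Nat.mod_lt _ hs⟩)
  invFun d := ⟨(s * d.1.1.1 + d.2.1, s * d.1.1.2 + d.2.2), by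
    obtain ⟨⟨⟨i, j⟩, h⟩, u, v⟩ := d
    have h1 : (s * i + u) / s = i := by
      rw [Nat.mul_add_div hs, Nat.div_eq_of_lt u.2, add_zero]
    have h2 : (s * j + v) / s = j := by
      rw [Nat.mul_add_div hs, Nat.div_eq_of_lt v.2, add_zero]
    have hi : i < μ.colLen 0 :=
      YoungDiagram.mem_iff_lt_colLen.1 (μ.up_left_mem le_rfl (Nat.zero_le j) h)
    have hj : j < μ.rowLen 0 :=
      YoungDiagram.mem_iff_lt_rowLen.1 (μ.up_left_mem (Nat.zero_le i) le_rfl h)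
    simp only [dilate, Finset.mem_filter, Finset.mem_product, Finset.mem_range, h1, h2]
    refine ⟨⟨?_, ?_⟩, h⟩
    · rwa [mul_comm s (μ.colLen 0), ← Nat.div_lt_iff_lt_mul hs, h1]
    · rwa [mul_comm s (μ.rowLen 0), ← Nat.div_lt_iff_lt_mul hs, h2]⟩
  left_inv c := by
    apply Subtype.ext
    simp [Nat.div_add_mod]
  right_inv d := by
    obtain ⟨⟨⟨i, j⟩, h⟩, u, v⟩ := d
    have h1 : (s * i + u) / s = i := by
      rw [Nat.mul_add_div hs, Nat.div_eq_of_lt u.2, add_zero]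
    have h2 : (s * j + v) / s = j := by
      rw [Nat.mul_add_div hs, Nat.div_eq_of_lt v.2, add_zero]
    simp [h1, h2, Nat.mod_eq_of_lt]

variable {Y : Type*} [Fintype Y]

/-- The fillings by cells of `μ` whose rows are constant on the cycles of `σ` and whose columns are
constant on the cycles of `τ`. -/
abbrev CompatibleFilling (μ : YoungDiagram) (σ τ : Equiv.Perm Y) : Type _ :=
  {f : Y → {c // c ∈ μ.cells} //
    (∀ y, (f (τ y)).1.2 = (f y).1.2) ∧ ∀ y, (f (σ y)).1.1 = (f y).1.1}

/-- A compatible filling of a dilated diagram is a compatible filling of `μ` together with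
colorings of the cycles by the positions in the grid. -/
def compatibleFillingDilateEquiv (μ : YoungDiagram) {s : ℕ} (hs : 0 < s) (σ τ : Equiv.Perm Y) :
    CompatibleFilling (dilate μ s) σ τ ≃ CompatibleFilling μ σ τ ×
      {u : Y → Fin s // ∀ y, u (σ y) = u y} × {v : Y → Fin s // ∀ y, v (τ y) = v y} where
  toFun f := (⟨fun y => (dilateCellsEquiv μ hs (f.1 y)).1,
      fun y => congrArg (· / s) (f.2.1 y), fun y => congrArg (· / s) (f.2.2 y)⟩,
    ⟨fun y => (dilateCellsEquiv μ hs (f.1 y)).2.1,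
      fun y => Fin.ext (congrArg (· % s) (f.2.2 y))⟩,
    ⟨fun y => (dilateCellsEquiv μ hs (f.1 y)).2.2,
      fun y => Fin.ext (congrArg (· % s) (f.2.1 y))⟩)
  invFun g := ⟨fun y => (dilateCellsEquiv μ hs).symm (g.1.1 y, g.2.1.1 y, g.2.2.1 y), by
    obtain ⟨⟨f, hf⟩, ⟨u, hu⟩, ⟨v, hv⟩⟩ := g
    constructor
    · intro y
      simp [dilateCellsEquiv, hf.1 y, hv y]
    · intro y
      simp [dilateCellsEquiv, hf.2 y, hu y]⟩
  left_inv f := by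
    apply Subtype.ext
    funext y
    exact (dilateCellsEquiv μ hs).symm_apply_apply (f.1 y)
  right_inv g := by
    obtain ⟨⟨f, hf⟩, ⟨u, hu⟩, ⟨v, hv⟩⟩ := g
    simp

/-- Functions constant on the cycles of `σ` are functions on the set of cycles. -/
theorem card_invariant_functions (σ : Equiv.Perm Y) (s : ℕ) :
    Nat.card {u : Y → Fin s // ∀ y, u (σ y) = u y} =
      s ^ Nat.card (Quotient (Equiv.Perm.SameCycle.setoid σ)) := by
  have e : {u : Y → Fin s // ∀ y, u (σ y) = u y} ≃
      (Quotient (Equiv.Perm.SameCycle.setoid σ) → Fin s) :=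
    { toFun := fun u => Quotient.lift u.1 (by
        intro a b hab
        obtain ⟨i, rfl⟩ := Equiv.Perm.SameCycle.exists_nat_pow_eq hab
        induction i with
        | zero => rfl
        | succ i ih => rw [pow_succ', Equiv.Perm.mul_apply, u.2, ← ih ⟨i, by simp⟩])
      invFun := fun w => ⟨fun y => w ⟦y⟧, fun y => congrArg w (Quotient.sound ⟨-1, by simp⟩)⟩
      left_inv := fun u => rfl
      right_inv := fun w => by
        funext q
        induction q using Quotient.inductionOn
        rfl }
  rw [Nat.card_congr e, Nat.card_fun, Nat.card_fin]

theorem card_compatibleFilling_dilate (μ : YoungDiagram) {s : ℕ} (hs : 0 < s)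
    (σ τ : Equiv.Perm Y) :
    Nat.card (CompatibleFilling (dilate μ s) σ τ) = Nat.card (CompatibleFilling μ σ τ) *
      s ^ (Nat.card (Quotient (Equiv.Perm.SameCycle.setoid σ)) +
        Nat.card (Quotient (Equiv.Perm.SameCycle.setoid τ))) := by
  rw [Nat.card_congr (compatibleFillingDilateEquiv μ hs σ τ), Nat.card_prod, Nat.card_prod,
    card_invariant_functions, card_invariant_functions, pow_add]

end Dilation

theorem normChar_eq_sum_card {k : ℕ} (μ : YoungDiagram) (π : Equiv.Perm (Fin k)) :
    normChar μ π = ∑ τ : Equiv.Perm (Fin k),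
      ((Equiv.Perm.sign τ : ℤ) : ℚ) * Nat.card (CompatibleFilling μ (π⁻¹ * τ⁻¹) τ) := by
  rw [normChar_eq_sum]
  unfold signedFactorizations
  rw [Finset.sum_comm]
  refine Finset.sum_congr rfl fun τ _ => ?_
  rw [Nat.card_eq_fintype_card, Fintype.card_subtype, mul_comm, ← nsmul_eq_mul,
    ← Finset.sum_const, Finset.sum_filter]
  congr!

/-- For any fixed `π ∈ S_k` and any fixed Young diagram `μ`, the function
`s ↦ Σ_π^{sμ}` (on positive integers `s`) agrees with a polynomial in `s`. -/
theorem normChar_dilate_polynomial {k : ℕ} (μ : YoungDiagram) (π : Equiv.Perm (Fin k)) :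
    ∃ p : Polynomial ℚ, ∀ s : ℕ, 0 < s →
      normChar (dilate μ s) π = Polynomial.eval (s : ℚ) p := by
  refine ⟨∑ τ : Equiv.Perm (Fin k),
    Polynomial.C (((Equiv.Perm.sign τ : ℤ) : ℚ) *
        Nat.card (CompatibleFilling μ (π⁻¹ * τ⁻¹) τ)) *
      Polynomial.X ^ (Nat.card (Quotient (Equiv.Perm.SameCycle.setoid (π⁻¹ * τ⁻¹))) +
        Nat.card (Quotient (Equiv.Perm.SameCycle.setoid τ))), fun s hs => ?_⟩
  rw [normChar_eq_sum_card, Polynomial.eval_finsetSum]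
  refine Finset.sum_congr rfl fun τ _ => ?_
  rw [card_compatibleFilling_dilate μ hs]
  simp [mul_assoc]

end AsympRep
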